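/- Let (Ω, 𝒜, μ) be a non-atomic finite measure space, X a separable Banach space, p ∈ [1,∞), and M : Ω ⇉ X a measurable multifunction with nonempty closed values such that S_M^p ≠ ∅, where S_M^p denotes the set of p-integrable selections of M. Suppose φ : Ω × X → [0,∞) is a convex normal integrand with { x : φ_ω(x) = 0 } = cl co M(ω) for a.e. ω and I_φ finite on L^p(Ω,X). Then the weak closure of S_M^p in L^p(Ω, X) equals { x ∈ L^p(Ω,X) : ∫_Ω φ_ω(x(ω)) dμ(ω) = 0 }. -/

import Mathlib

open MeasureTheory
open scoped ENNReal

section WeakClosure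

variable {E : Type*} [NormedAddCommGroup E] [NormedSpace ℝ E]

/-- The closure of a subset of a normed space in the weak topology. -/
def weakClosure (S : Set E) : Set E :=
  toWeakSpace ℝ E ⁻¹' closure (toWeakSpace ℝ E '' S)

theorem subset_weakClosure (S : Set E) : S ⊆ weakClosure S :=
  fun _ hx => subset_closure (X := WeakSpace ℝ E) (Set.mem_image_of_mem _ hx)

theorem isClosed_weakClosure (S : Set E) : IsClosed (weakClosure S) :=
  isClosed_closure.preimage (toWeakSpaceCLM ℝ E).continuous

theorem weakClosure_subset_of_convex {S C : Set E} (hSC : S ⊆ C) (hconv : Convex ℝ C)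
    (hcl : IsClosed C) : weakClosure S ⊆ C := by
  intro x hx
  have h : toWeakSpace ℝ E x ∈ closure (toWeakSpace ℝ E '' C) :=
    closure_mono (X := WeakSpace ℝ E) (Set.image_mono hSC) hx
  rw [← hconv.toWeakSpace_closure ℝ, hcl.closure_eq] at h
  exact (toWeakSpace ℝ E).injective.mem_set_image.1 h

theorem mem_weakClosure_of_forall_finset {S : Set E} {z : E}
    (h : ∀ (F : Finset (StrongDual ℝ E)) (ε : ℝ), 0 < ε → ∃ s ∈ S, ∀ f ∈ F, |f (s - z)| < ε) :
    z ∈ weakClosure S := by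
  choose! s hsS hs using h
  classical
  let u : Finset (StrongDual ℝ E) × ℕ → E := fun i => s i.1 (1 / ((i.2 : ℝ) + 1))
  have hu : Filter.Tendsto (fun i => toWeakSpace ℝ E (u i)) Filter.atTop (nhds (toWeakSpace ℝ E z)) := by
    refine (WeakBilin.tendsto_iff_forall_eval_tendsto (B := (topDualPairing ℝ E).flip) ?_).2 ?_
    · intro x y hxy
      refine (SeparatingDual.eq_iff_forall_dual_eq (R := ℝ)).2 fun f => ?_
      exact LinearMap.congr_fun hxy f
    intro f
    change Filter.Tendsto (fun i => f (u i)) Filter.atTop (nhds (f z))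
    rw [Metric.tendsto_nhds]
    intro ε hε
    obtain ⟨n, hn⟩ := exists_nat_one_div_lt hε
    filter_upwards [Filter.eventually_ge_atTop (({f}, n) : Finset (StrongDual ℝ E) × ℕ)] with i hi
    rw [Real.dist_eq, ← map_sub]
    refine (hs i.1 _ Nat.one_div_pos_of_nat f (hi.1 (Finset.mem_singleton_self f))).trans_le ?_
    exact (Nat.one_div_le_one_div hi.2).trans hn.le
  exact mem_closure_of_tendsto (X := WeakSpace ℝ E) hu
    (Filter.Eventually.of_forall fun i => ⟨_, hsS _ _ Nat.one_div_pos_of_nat, rfl⟩)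

theorem add_mem_weakClosure {S : Set E} (T T' : E →L[ℝ] E)
    (h : ∀ x ∈ S, ∀ y ∈ S, T x + T' y ∈ weakClosure S) {x y : E}
    (hx : x ∈ weakClosure S) (hy : y ∈ weakClosure S) : T x + T' y ∈ weakClosure S := by
  have hc : Continuous (Function.uncurry fun a b : WeakSpace ℝ E =>
      WeakSpace.map T a + WeakSpace.map T' b) := by
    unfold Function.uncurry
    exact ((WeakSpace.map T).continuous.comp continuous_fst).add
      ((WeakSpace.map T').continuous.comp continuous_snd)
  have := map_mem_closure₂ (u := closure (toWeakSpace ℝ E '' S)) hc hx hy ?_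
  · rw [closure_closure] at this
    exact this
  · rintro _ ⟨a, ha, rfl⟩ _ ⟨b, hb, rfl⟩
    exact h a ha b hb

end WeakClosure

/-- A closed set which is stable under taking midpoints is convex. -/
theorem IsClosed.convex_of_half_add {E : Type*} [NormedAddCommGroup E] [NormedSpace ℝ E] {s : Set E}
    (hs : IsClosed s) (h : ∀ x ∈ s, ∀ y ∈ s, (1 / 2 : ℝ) • x + (1 / 2 : ℝ) • y ∈ s) :
    Convex ℝ s := by
  rw [convex_iff_segment_subset]
  intro x hx y hy
  have hdyadic : ∀ (n : ℕ) (t : ℝ), 0 ≤ t → t ≤ 1 →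
      ∃ r : ℝ, AffineMap.lineMap x y r ∈ s ∧ |t - r| ≤ (1 / 2) ^ n := by
    intro n
    induction n with
    | zero =>
      intro t h0 h1
      refine ⟨0, by simpa using hx, ?_⟩
      rw [sub_zero, abs_of_nonneg h0, pow_zero]
      exact h1
    | succ n ih =>
      intro t h0 h1
      rcases le_total t (1 / 2) with ht | ht
      · obtain ⟨r, hr, htr⟩ := ih (2 * t) (by linarith) (by linarith)
        refine ⟨r / 2, ?_, ?_⟩
        · convert h x hx _ hr using 1
          simp only [AffineMap.lineMap_apply_module]
          module
        · rw [abs_le] at htr ⊢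
          rw [pow_succ]
          constructor <;> linarith
      · obtain ⟨r, hr, htr⟩ := ih (2 * t - 1) (by linarith) (by linarith)
        refine ⟨(r + 1) / 2, ?_, ?_⟩
        · convert h y hy _ hr using 1
          simp only [AffineMap.lineMap_apply_module]
          module
        · rw [abs_le] at htr ⊢
          rw [pow_succ]
          constructor <;> linarith
  rw [segment_eq_image_lineMap]
  rintro _ ⟨t, ⟨h0, h1⟩, rfl⟩
  choose r hrs hr using fun n => hdyadic n t h0 h1
  have hlim : Filter.Tendsto r Filter.atTop (nhds t) := by
    rw [tendsto_iff_dist_tendsto_zero]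
    refine squeeze_zero (fun _ => dist_nonneg) (fun n => ?_)
      (tendsto_pow_atTop_nhds_zero_of_lt_one (r := (1 / 2 : ℝ)) (by norm_num) (by norm_num))
    rw [dist_comm, Real.dist_eq]
    exact hr n
  have hcont : Continuous fun t : ℝ => (AffineMap.lineMap x y t : E) :=
    AffineMap.lineMap_continuous
  exact hs.mem_of_tendsto ((hcont.tendsto t).comp hlim) (Filter.Eventually.of_forall hrs)

section Nonatomic

variable {Ω : Type*} [MeasurableSpace Ω] {μ : Measure Ω} [IsFiniteMeasure μ]

theorem exists_subset_measure_le_of_nonatomic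
    (hna : ∀ s : Set Ω, MeasurableSet s → μ s ≠ 0 →
      ∃ t ⊆ s, MeasurableSet t ∧ μ t ≠ 0 ∧ μ t ≠ μ s)
    {s : Set Ω} (hs : MeasurableSet s) (hs0 : μ s ≠ 0) {ε : ℝ≥0∞} (hε : ε ≠ 0) :
    ∃ t ⊆ s, MeasurableSet t ∧ μ t ≠ 0 ∧ μ t ≤ ε := by
  have hhalf : ∀ n : ℕ, ∃ t ⊆ s, MeasurableSet t ∧ μ t ≠ 0 ∧ μ t ≤ μ s * 2⁻¹ ^ n := by
    intro n
    induction n with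
    | zero => exact ⟨s, subset_rfl, hs, hs0, by simp⟩
    | succ n ih =>
      obtain ⟨t, hts, htm, ht0, htle⟩ := ih
      obtain ⟨r, hrt, hrm, hr0, hrne⟩ := hna t htm ht0
      have hadd : μ r + μ (t \ r) = μ t := by
        rw [measure_add_sdiff hrm.nullMeasurableSet t, Set.union_eq_self_of_subset_left hrt]
      have hd0 : μ (t \ r) ≠ 0 := by
        intro h
        rw [h, add_zero] at hadd
        exact hrne hadd
      have hgoal : μ t / 2 ≤ μ s * 2⁻¹ ^ (n + 1) := by
        rw [pow_succ, ← mul_assoc, ENNReal.div_eq_inv_mul, mul_comm]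
        gcongr
      rcases le_total (μ r) (μ (t \ r)) with h | h
      · refine ⟨r, hrt.trans hts, hrm, hr0, le_trans ?_ hgoal⟩
        rw [ENNReal.le_div_iff_mul_le (by simp) (by simp), mul_two, ← hadd]
        gcongr
      · refine ⟨t \ r, Set.sdiff_subset.trans hts, htm.diff hrm, hd0, le_trans ?_ hgoal⟩
        rw [ENNReal.le_div_iff_mul_le (by simp) (by simp), mul_two, ← hadd]
        gcongr
  have hlim : Filter.Tendsto (fun n : ℕ => μ s * 2⁻¹ ^ n) Filter.atTop (nhds 0) := by
    have := ENNReal.Tendsto.const_mul (a := μ s)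
      (ENNReal.tendsto_pow_atTop_nhds_zero_of_lt_one (r := 2⁻¹) (by simp))
      (Or.inr (measure_ne_top μ s))
    simpa using this
  obtain ⟨n, hn⟩ := (hlim.eventually_lt_const (pos_iff_ne_zero.2 hε)).exists
  obtain ⟨t, hts, htm, ht0, htle⟩ := hhalf n
  exact ⟨t, hts, htm, ht0, htle.trans hn.le⟩

theorem exists_finset_cover_of_nonatomic
    (hna : ∀ s : Set Ω, MeasurableSet s → μ s ≠ 0 →
      ∃ t ⊆ s, MeasurableSet t ∧ μ t ≠ 0 ∧ μ t ≠ μ s) {ε : ℝ≥0∞} (hε : ε ≠ 0) :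
    ∃ F : Finset (Set Ω), (∀ e ∈ F, MeasurableSet e ∧ μ e ≤ ε) ∧ ⋃₀ (F : Set (Set Ω)) = Set.univ := by
  classical
  let good : Set (Set Ω) :=
    {s | ∃ F : Finset (Set Ω), (∀ e ∈ F, MeasurableSet e ∧ μ e ≤ ε) ∧ ⋃₀ (F : Set (Set Ω)) = s}
  have hgood_meas : ∀ s ∈ good, MeasurableSet s := by
    rintro _ ⟨F, hF, rfl⟩
    exact MeasurableSet.sUnion F.countable_toSet fun e he => (hF e he).1
  have hgood_union : ∀ s ∈ good, ∀ t ∈ good, s ∪ t ∈ good := by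
    rintro _ ⟨F, hF, rfl⟩ _ ⟨G, hG, rfl⟩
    refine ⟨F ∪ G, fun e he => ?_, by rw [Finset.coe_union, Set.sUnion_union]⟩
    rcases Finset.mem_union.1 he with h | h
    exacts [hF e h, hG e h]
  have hgood_small : ∀ s, MeasurableSet s → μ s ≤ ε → s ∈ good := fun s hs hsε =>
    ⟨{s}, by simpa using ⟨hs, hsε⟩, by simp⟩
  have hgood_empty : ∅ ∈ good := hgood_small ∅ .empty (by simp)
  obtain ⟨v, -, hvlim, hv⟩ := exists_seq_tendsto_sSup
    (S := μ '' good) ⟨_, Set.mem_image_of_mem μ hgood_empty⟩ (OrderTop.bddAbove _)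
  choose g hg hgv using hv
  have hacc : ∀ n, Set.accumulate g n ∈ good := by
    intro n
    induction n with
    | zero => rw [Set.accumulate_zero_nat]; exact hg 0
    | succ n ih => rw [Set.accumulate_succ]; exact hgood_union _ ih _ (hg _)
  have hacc_lim : Filter.Tendsto (fun n => μ (Set.accumulate g n)) Filter.atTop
      (nhds (μ (⋃ n, g n))) := tendsto_measure_iUnion_accumulate
  have hle : ∀ s ∈ good, μ s ≤ μ (⋃ n, g n) := by
    intro s hs
    refine (le_sSup (Set.mem_image_of_mem μ hs)).trans (le_of_tendsto hvlim ?_)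
    exact Filter.Eventually.of_forall fun n => hgv n ▸ measure_mono (Set.subset_iUnion g n)
  have hgm : MeasurableSet (⋃ n, g n) := .iUnion fun n => hgood_meas _ (hg n)
  have hcompl : μ (⋃ n, g n)ᶜ = 0 := by
    by_contra h0
    obtain ⟨t, hts, htm, ht0, htε⟩ := exists_subset_measure_le_of_nonatomic hna hgm.compl h0 hε
    have hlim : Filter.Tendsto (fun n => μ (Set.accumulate g n) + μ t) Filter.atTop
        (nhds (μ (⋃ n, g n) + μ t)) := hacc_lim.add tendsto_const_nhds
    have hbound : μ (⋃ n, g n) + μ t ≤ μ (⋃ n, g n) := by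
      refine le_of_tendsto hlim (Filter.Eventually.of_forall fun n => ?_)
      have hdisj : Disjoint (Set.accumulate g n) t := by
        refine Set.disjoint_left.2 fun ω hω hωt => hts hωt ?_
        exact Set.iUnion_mono' (fun i => ⟨i, by simp⟩) (Set.accumulate_subset_iUnion n hω)
      rw [← measure_union hdisj htm]
      exact hle _ (hgood_union _ (hacc n) _ (hgood_small t htm htε))
    exact (ENNReal.lt_add_right (measure_ne_top μ _) ht0).not_ge hbound
  have hrest : Filter.Tendsto (fun n => μ (Set.accumulate g n)ᶜ) Filter.atTop (nhds 0) := by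
    have h : Filter.Tendsto (fun n => μ Set.univ - μ (Set.accumulate g n)) Filter.atTop
        (nhds (μ Set.univ - μ (⋃ n, g n))) :=
      ENNReal.Tendsto.sub tendsto_const_nhds hacc_lim (Or.inl (measure_ne_top μ _))
    rw [← measure_compl hgm (measure_ne_top μ _), hcompl] at h
    refine h.congr fun n => ?_
    rw [measure_compl (hgood_meas _ (hacc n)) (measure_ne_top μ _)]
  obtain ⟨n, hn⟩ := (hrest.eventually_lt_const (pos_iff_ne_zero.2 hε)).exists
  have huniv := hgood_union _ (hacc n) _
    (hgood_small _ (hgood_meas _ (hacc n)).compl hn.le)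
  rw [Set.union_compl_self] at huniv
  exact huniv

theorem exists_partition_of_nonatomic
    (hna : ∀ s : Set Ω, MeasurableSet s → μ s ≠ 0 →
      ∃ t ⊆ s, MeasurableSet t ∧ μ t ≠ 0 ∧ μ t ≠ μ s) {ε : ℝ≥0∞} (hε : ε ≠ 0) :
    ∃ (N : ℕ) (E : ℕ → Set Ω), (∀ k, MeasurableSet (E k)) ∧ (∀ k, μ (E k) ≤ ε) ∧
      Pairwise (Function.onFun Disjoint E) ∧ ⋃ k ∈ Finset.range N, E k = Set.univ := by
  obtain ⟨F, hF, hcover⟩ := exists_finset_cover_of_nonatomic hna hε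
  let e : ℕ → Set Ω := fun k => F.toList.getD k ∅
  have he : ∀ k, MeasurableSet (e k) ∧ μ (e k) ≤ ε := by
    intro k
    by_cases hk : k < F.toList.length
    · have : e k = F.toList[k] := List.getD_eq_getElem _ _ hk
      rw [this]
      exact hF _ (Finset.mem_toList.1 (List.getElem_mem hk))
    · have : e k = ∅ := List.getD_eq_default _ _ (not_lt.1 hk)
      simp [this]
  refine ⟨F.toList.length, disjointed e, fun k => .disjointed (fun i => (he i).1) k,
    fun k => (measure_mono (disjointed_subset e k)).trans (he k).2, disjoint_disjointed e, ?_⟩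
  rw [Set.eq_univ_iff_forall]
  intro ω
  obtain ⟨s, hsF, hωs⟩ := Set.mem_sUnion.1 (hcover ▸ Set.mem_univ ω)
  obtain ⟨k, hk, rfl⟩ := List.getElem_of_mem (Finset.mem_toList.2 hsF)
  have hωk : ω ∈ ⋃ i, disjointed e i := by
    rw [iUnion_disjointed]
    refine Set.mem_iUnion.2 ⟨k, ?_⟩
    rwa [show e k = F.toList[k] from List.getD_eq_getElem _ _ hk]
  obtain ⟨i, hi⟩ := Set.mem_iUnion.1 hωk
  have hil : i < F.toList.length := by
    by_contra hil
    have : e i = ∅ := List.getD_eq_default _ _ (not_lt.1 hil)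
    have := disjointed_subset e i hi
    simp_all
  exact Set.mem_iUnion₂.2 ⟨i, Finset.mem_range.2 hil, hi⟩

end Nonatomic

/-- Vectors in a Euclidean space can be signed so that the squared norm of their signed sum
is at most the sum of their squared norms. -/
theorem exists_signs_sum_sq_le {ι : Type*} (F : Finset ι) (v : ℕ → ι → ℝ) (N : ℕ) :
    ∃ J ⊆ Finset.range N, ∑ i ∈ F, (∑ k ∈ J, v k i - ∑ k ∈ Finset.range N \ J, v k i) ^ 2
      ≤ ∑ k ∈ Finset.range N, ∑ i ∈ F, v k i ^ 2 := by
  induction N with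
  | zero => exact ⟨∅, by simp, by simp⟩
  | succ N ih =>
    obtain ⟨J, hJ, hle⟩ := ih
    have hNJ : N ∉ J := fun h => by simpa using hJ h
    have hJ' : J ⊆ Finset.range (N + 1) :=
      hJ.trans (Finset.range_mono N.le_succ)
    set a : ι → ℝ := fun i => ∑ k ∈ J, v k i - ∑ k ∈ Finset.range N \ J, v k i with ha
    rcases le_total (∑ i ∈ F, a i * v N i) 0 with h | h
    · refine ⟨insert N J, ?_, ?_⟩
      · exact Finset.insert_subset (by simp) hJ'
      have hset : Finset.range (N + 1) \ insert N J = Finset.range N \ J := by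
        ext k; simp only [Finset.mem_sdiff, Finset.mem_range, Finset.mem_insert]; grind
      rw [hset, Finset.sum_range_succ]
      calc _ = ∑ i ∈ F, (a i ^ 2 + 2 * (a i * v N i) + v N i ^ 2) := by
            refine Finset.sum_congr rfl fun i _ => ?_
            rw [Finset.sum_insert hNJ, ha]; ring
        _ = ∑ i ∈ F, a i ^ 2 + 2 * ∑ i ∈ F, a i * v N i + ∑ i ∈ F, v N i ^ 2 := by
            rw [Finset.sum_add_distrib, Finset.sum_add_distrib, Finset.mul_sum]
        _ ≤ _ := by linarith
    · refine ⟨J, hJ', ?_⟩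
      have hset : Finset.range (N + 1) \ J = insert N (Finset.range N \ J) := by
        ext k; simp only [Finset.mem_sdiff, Finset.mem_range, Finset.mem_insert]; grind
      rw [hset, Finset.sum_range_succ]
      calc _ = ∑ i ∈ F, (a i ^ 2 - 2 * (a i * v N i) + v N i ^ 2) := by
            refine Finset.sum_congr rfl fun i _ => ?_
            rw [Finset.sum_insert (by simp), ha]; ring
        _ = ∑ i ∈ F, a i ^ 2 - 2 * ∑ i ∈ F, a i * v N i + ∑ i ∈ F, v N i ^ 2 := by
            rw [Finset.sum_add_distrib, Finset.sum_sub_distrib, Finset.mul_sum]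
        _ ≤ _ := by linarith

section Decomposable

variable {Ω : Type*} [MeasurableSpace Ω] {μ : Measure Ω}
  {X : Type*} [NormedAddCommGroup X] [NormedSpace ℝ X] {p : ℝ≥0∞}

/-- Multiplication by the indicator function of a measurable set, as a linear map on `L^p`. -/
noncomputable def lpIndicatorₗ {A : Set Ω} (hA : MeasurableSet A) : Lp X p μ →ₗ[ℝ] Lp X p μ where
  toFun u := ((Lp.memLp u).indicator hA).toLp _
  map_add' u v := by
    rw [← MemLp.toLp_add]
    refine MemLp.toLp_congr _ _ ?_
    filter_upwards [Lp.coeFn_add u v] with ω hω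
    rw [Pi.add_apply] at hω ⊢
    by_cases h : ω ∈ A
    · rw [Set.indicator_of_mem h, Set.indicator_of_mem h, Set.indicator_of_mem h, hω]
    · rw [Set.indicator_of_notMem h, Set.indicator_of_notMem h, Set.indicator_of_notMem h,
        add_zero]
  map_smul' c u := by
    rw [RingHom.id_apply, ← MemLp.toLp_const_smul]
    refine MemLp.toLp_congr _ _ ?_
    filter_upwards [Lp.coeFn_smul c u] with ω hω
    rw [Pi.smul_apply] at hω ⊢
    by_cases h : ω ∈ A
    · rw [Set.indicator_of_mem h, Set.indicator_of_mem h, hω]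
    · rw [Set.indicator_of_notMem h, Set.indicator_of_notMem h, smul_zero]

theorem lpIndicatorₗ_apply {A : Set Ω} (hA : MeasurableSet A) (u : Lp X p μ) :
    lpIndicatorₗ hA u = ((Lp.memLp u).indicator hA).toLp _ :=
  rfl

theorem coeFn_lpIndicatorₗ {A : Set Ω} (hA : MeasurableSet A) (u : Lp X p μ) :
    lpIndicatorₗ hA u =ᵐ[μ] A.indicator u := by
  rw [lpIndicatorₗ_apply]
  exact MemLp.coeFn_toLp _

theorem norm_lpIndicatorₗ_le {A : Set Ω} (hA : MeasurableSet A) (u : Lp X p μ) :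
    ‖lpIndicatorₗ hA u‖ ≤ ‖u‖ := by
  refine Lp.norm_le_norm_of_ae_le ?_
  filter_upwards [coeFn_lpIndicatorₗ hA u] with ω hω
  rw [hω]
  exact norm_indicator_le_norm_self _ _

variable [Fact (1 ≤ p)]

/-- Multiplication by the indicator function of a measurable set, as an operator on `L^p`. -/
noncomputable def lpIndicator {A : Set Ω} (hA : MeasurableSet A) : Lp X p μ →L[ℝ] Lp X p μ :=
  (lpIndicatorₗ hA).mkContinuous 1 fun u => by
    rw [one_mul]
    exact norm_lpIndicatorₗ_le hA u

theorem coeFn_lpIndicator {A : Set Ω} (hA : MeasurableSet A) (u : Lp X p μ) :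
    lpIndicator hA u =ᵐ[μ] A.indicator u :=
  coeFn_lpIndicatorₗ hA u

theorem norm_lpIndicator_le {A : Set Ω} (hA : MeasurableSet A) (u : Lp X p μ) :
    ‖lpIndicator hA u‖ ≤ ‖u‖ :=
  norm_lpIndicatorₗ_le hA u

theorem lpIndicator_congr {A B : Set Ω} (hA : MeasurableSet A) (hB : MeasurableSet B)
    (h : A = B) (u : Lp X p μ) : lpIndicator hA u = lpIndicator hB u := by
  subst h
  rfl

theorem lpIndicator_add_compl {A : Set Ω} (hA : MeasurableSet A) (u : Lp X p μ) :
    lpIndicator hA u + lpIndicator hA.compl u = u := by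
  refine Lp.ext ?_
  filter_upwards [Lp.coeFn_add (lpIndicator hA u) (lpIndicator hA.compl u),
    coeFn_lpIndicator hA u, coeFn_lpIndicator hA.compl u] with ω h h₁ h₂
  rw [h, Pi.add_apply, h₁, h₂]
  exact congr_fun (Set.indicator_self_add_compl A u) ω

theorem lpIndicator_biUnion {E : ℕ → Set Ω} (hE : ∀ k, MeasurableSet (E k))
    (hdisj : Pairwise (Function.onFun Disjoint E)) (J : Finset ℕ)
    (hJ : MeasurableSet (⋃ k ∈ J, E k)) (u : Lp X p μ) :
    lpIndicator hJ u = ∑ k ∈ J, lpIndicator (hE k) u := by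
  refine Lp.ext ?_
  have hall : ∀ᵐ ω ∂μ, ∀ k, lpIndicator (hE k) u ω = (E k).indicator u ω :=
    ae_all_iff.2 fun k => coeFn_lpIndicator (hE k) u
  filter_upwards [coeFn_lpIndicator hJ u, Lp.coeFn_finsetSum J fun k => lpIndicator (hE k) u,
    hall] with ω h₁ h₂ h₃
  rw [h₁, h₂, Finset.sum_apply, Finset.sum_congr rfl fun k _ => h₃ k]
  exact congr_fun (Finset.indicator_biUnion J E fun i _ j _ hij => hdisj hij) ω

theorem sum_abs_lpIndicator_le {E : ℕ → Set Ω} (hE : ∀ k, MeasurableSet (E k))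
    (hdisj : Pairwise (Function.onFun Disjoint E)) (J : Finset ℕ)
    (f : StrongDual ℝ (Lp X p μ)) (u : Lp X p μ) :
    ∑ k ∈ J, |f (lpIndicator (hE k) u)| ≤ 2 * (‖f‖ * ‖u‖) := by
  have hbound : ∀ I : Finset ℕ, |∑ k ∈ I, f (lpIndicator (hE k) u)| ≤ ‖f‖ * ‖u‖ := by
    intro I
    have hI : MeasurableSet (⋃ k ∈ I, E k) := I.measurableSet_biUnion fun k _ => hE k
    rw [← map_sum, ← lpIndicator_biUnion hE hdisj I hI, ← Real.norm_eq_abs]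
    exact (f.le_opNorm _).trans (by gcongr; exact norm_lpIndicator_le hI u)
  rw [← Finset.sum_filter_add_sum_filter_not J fun k => 0 ≤ f (lpIndicator (hE k) u), two_mul]
  refine add_le_add ?_ ?_
  · refine le_of_eq_of_le ?_ ((le_abs_self _).trans
      (hbound (J.filter fun k => 0 ≤ f (lpIndicator (hE k) u))))
    exact Finset.sum_congr rfl fun k hk => abs_of_nonneg (Finset.mem_filter.1 hk).2
  · refine le_of_eq_of_le ?_ ((neg_le_abs _).trans
      (hbound (J.filter fun k => ¬ 0 ≤ f (lpIndicator (hE k) u))))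
    rw [← Finset.sum_neg_distrib]
    exact Finset.sum_congr rfl fun k hk => abs_of_neg (not_le.1 (Finset.mem_filter.1 hk).2)

/-- On a non-atomic space, finitely many functionals are almost bisected by a measurable set. -/
theorem exists_measurableSet_bisecting [IsFiniteMeasure μ]
    (hna : ∀ s : Set Ω, MeasurableSet s → μ s ≠ 0 →
      ∃ t ⊆ s, MeasurableSet t ∧ μ t ≠ 0 ∧ μ t ≠ μ s)
    (hptop : p ≠ ⊤) (u : Lp X p μ) (F : Finset (StrongDual ℝ (Lp X p μ))) {ε : ℝ} (hε : 0 < ε) :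
    ∃ (A : Set Ω) (hA : MeasurableSet A),
      ∀ f ∈ F, |f (lpIndicator hA u) - f (lpIndicator hA.compl u)| < ε := by
  set B : ℝ := ∑ f ∈ F, ‖f‖ with hB
  have hB0 : 0 ≤ B := Finset.sum_nonneg fun f _ => norm_nonneg f
  have hfB : ∀ f ∈ F, ‖f‖ ≤ B := fun f hf =>
    Finset.single_le_sum (f := fun f : StrongDual ℝ (Lp X p μ) => ‖f‖)
      (fun g _ => norm_nonneg g) hf
  set η : ℝ := ε ^ 2 / (2 * B ^ 2 * ‖u‖ + 1) with hη
  have hden : 0 < 2 * B ^ 2 * ‖u‖ + 1 := by positivity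
  have hη0 : 0 < η := by positivity
  obtain ⟨δ, hδ0, hδ⟩ := (Lp.memLp u).eLpNorm_indicator_le Fact.out hptop hη0
  obtain ⟨N, E, hE, hEδ, hdisj, hcover⟩ :=
    exists_partition_of_nonatomic hna (ENNReal.ofReal_pos.2 hδ0).ne'
  have hEη : ∀ k, ‖lpIndicator (hE k) u‖ ≤ η := by
    intro k
    rw [Lp.norm_def, eLpNorm_congr_ae (coeFn_lpIndicator (hE k) u)]
    exact ENNReal.toReal_le_of_le_ofReal hη0.le (hδ (E k) (hE k) (hEδ k))
  obtain ⟨J, hJ, hJle⟩ :=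
    exists_signs_sum_sq_le F (fun k f => f (lpIndicator (hE k) u)) N
  have hm : ∀ I : Finset ℕ, MeasurableSet (⋃ k ∈ I, E k) := fun I =>
    I.measurableSet_biUnion fun k _ => hE k
  have hcompl : (⋃ k ∈ J, E k)ᶜ = ⋃ k ∈ Finset.range N \ J, E k := by
    ext ω
    have hω : ω ∈ ⋃ k ∈ Finset.range N, E k := hcover ▸ Set.mem_univ ω
    obtain ⟨k, hkN, hk⟩ := Set.mem_iUnion₂.1 hω
    have huniq : ∀ j, ω ∈ E j → j = k := fun j hj => by
      by_contra hjk
      exact Set.disjoint_left.1 (hdisj hjk) hj hk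
    simp only [Set.mem_compl_iff, Set.mem_iUnion, Finset.mem_sdiff, exists_prop, not_exists,
      not_and]
    constructor
    · exact fun h => ⟨k, ⟨hkN, fun hkJ => h k hkJ hk⟩, hk⟩
    · rintro ⟨j, ⟨-, hjJ⟩, hj⟩ i hiJ hi
      rw [huniq j hj, ← huniq i hi] at hjJ
      exact hjJ hiJ
  refine ⟨⋃ k ∈ J, E k, hm J, fun f hf => ?_⟩
  rw [lpIndicator_congr (hm J).compl (hm _) hcompl, lpIndicator_biUnion hE hdisj,
    lpIndicator_biUnion hE hdisj, map_sum, map_sum]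
  refine abs_lt_of_sq_lt_sq ?_ hε.le
  calc _ ≤ ∑ f ∈ F, (∑ k ∈ J, f (lpIndicator (hE k) u) -
          ∑ k ∈ Finset.range N \ J, f (lpIndicator (hE k) u)) ^ 2 :=
        Finset.single_le_sum (f := fun f : StrongDual ℝ (Lp X p μ) =>
          (∑ k ∈ J, f (lpIndicator (hE k) u) -
            ∑ k ∈ Finset.range N \ J, f (lpIndicator (hE k) u)) ^ 2)
          (fun g _ => sq_nonneg _) hf
    _ ≤ ∑ k ∈ Finset.range N, ∑ f ∈ F, f (lpIndicator (hE k) u) ^ 2 := hJle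
    _ ≤ ∑ f ∈ F, B * η * (2 * (‖f‖ * ‖u‖)) := by
        rw [Finset.sum_comm]
        refine Finset.sum_le_sum fun f hf => ?_
        refine le_trans ?_ (mul_le_mul_of_nonneg_left
          (sum_abs_lpIndicator_le hE hdisj (Finset.range N) f u) (by positivity))
        rw [Finset.mul_sum]
        refine Finset.sum_le_sum fun k _ => ?_
        rw [← sq_abs, sq]
        refine mul_le_mul_of_nonneg_right ?_ (abs_nonneg _)
        rw [← Real.norm_eq_abs]
        exact (f.le_opNorm _).trans (mul_le_mul (hfB f hf) (hEη k) (norm_nonneg _) hB0)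
    _ = η * (2 * B ^ 2 * ‖u‖) := by
        rw [← Finset.mul_sum, ← Finset.mul_sum, ← Finset.sum_mul, ← hB]
        ring
    _ < η * (2 * B ^ 2 * ‖u‖ + 1) := by gcongr; linarith
    _ = ε ^ 2 := div_mul_cancel₀ _ hden.ne'

/-- On a non-atomic space, the weak closure of a decomposable subset of `L^p` is stable under
taking midpoints. -/
theorem half_add_mem_weakClosure [IsFiniteMeasure μ]
    (hna : ∀ s : Set Ω, MeasurableSet s → μ s ≠ 0 →
      ∃ t ⊆ s, MeasurableSet t ∧ μ t ≠ 0 ∧ μ t ≠ μ s)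
    (hptop : p ≠ ⊤) {S : Set (Lp X p μ)}
    (hdec : ∀ (A : Set Ω) (hA : MeasurableSet A), ∀ x ∈ S, ∀ y ∈ S,
      lpIndicator hA x + lpIndicator hA.compl y ∈ S)
    {x y : Lp X p μ} (hx : x ∈ weakClosure S) (hy : y ∈ weakClosure S) :
    (1 / 2 : ℝ) • x + (1 / 2 : ℝ) • y ∈ weakClosure S := by
  refine add_mem_weakClosure ((1 / 2 : ℝ) • ContinuousLinearMap.id ℝ (Lp X p μ))
    ((1 / 2 : ℝ) • ContinuousLinearMap.id ℝ (Lp X p μ)) (fun s hs t ht => ?_) hx hy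
  refine mem_weakClosure_of_forall_finset fun F ε hε => ?_
  obtain ⟨A, hA, hF⟩ := exists_measurableSet_bisecting hna hptop (s - t) F hε
  refine ⟨_, hdec A hA s hs t ht, fun f hf => ?_⟩
  have hs' := lpIndicator_add_compl hA s
  have ht' := lpIndicator_add_compl hA t
  have hfs := congr_arg f hs'
  have hft := congr_arg f ht'
  have hlt := hF f hf
  simp only [map_add, map_sub] at hfs hft hlt
  simp only [smul_apply, ContinuousLinearMap.id_apply, map_add, map_sub,
    map_smul, smul_eq_mul]
  rw [abs_lt] at hlt ⊢
  constructor <;> linarith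

end Decomposable

section Selection

variable {Ω : Type*} [MeasurableSpace Ω]
  {X : Type*} [NormedAddCommGroup X] [TopologicalSpace.SeparableSpace X] [MeasurableSpace X]
  [BorelSpace X] {F : Ω → Set X}

theorem exists_measurable_refinement
    (hF : ∀ U : Set X, IsOpen U → MeasurableSet {ω : Ω | (F ω ∩ U).Nonempty})
    {g : Ω → X} (hg : Measurable g) {r : ℝ} (hr : 0 < r)
    (h : ∀ ω, (F ω ∩ Metric.ball (g ω) r).Nonempty) :
    ∃ g' : Ω → X, Measurable g' ∧
      ∀ ω, (F ω ∩ Metric.ball (g' ω) (r / 2)).Nonempty ∧ dist (g ω) (g' ω) ≤ 2 * r := by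
  classical
  let d := TopologicalSpace.denseSeq X
  let q : ℕ → Ω → Prop := fun k ω =>
    (F ω ∩ Metric.ball (d k) (r / 2)).Nonempty ∧ dist (g ω) (d k) ≤ 2 * r
  have hq : ∀ ω, ∃ k, q k ω := by
    intro ω
    obtain ⟨y, hyF, hyg⟩ := h ω
    obtain ⟨k, hk⟩ := Metric.denseRange_iff.1 (TopologicalSpace.denseRange_denseSeq X) y
      (r / 2) (half_pos hr)
    refine ⟨k, ⟨y, hyF, hk⟩, ?_⟩
    rw [Metric.mem_ball, dist_comm] at hyg
    calc dist (g ω) (d k) ≤ dist (g ω) y + dist y (d k) := dist_triangle _ _ _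
      _ ≤ 2 * r := by linarith
  have hqm : ∀ k, MeasurableSet {ω | q k ω} := fun k =>
    (hF _ Metric.isOpen_ball).inter
      (measurableSet_le (hg.dist measurable_const) measurable_const)
  exact ⟨fun ω => d (Nat.find (hq ω)),
    Measurable.find (f := fun k _ => d k) (fun _ => measurable_const) hqm hq,
    fun ω => Nat.find_spec (hq ω)⟩

theorem exists_measurable_selection_of_ball [CompleteSpace X] (hcl : ∀ ω, IsClosed (F ω))
    (hF : ∀ U : Set X, IsOpen U → MeasurableSet {ω : Ω | (F ω ∩ U).Nonempty})
    (d : X) {r : ℝ} (hr : 0 < r) (h : ∀ ω, (F ω ∩ Metric.ball d r).Nonempty) :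
    ∃ f : Ω → X, Measurable f ∧ ∀ ω, f ω ∈ F ω ∧ dist d (f ω) ≤ 4 * r := by
  choose! next hnextm hnext using
    fun (g : Ω → X) (hg : Measurable g) (r : ℝ) (hr : 0 < r)
      (h : ∀ ω, (F ω ∩ Metric.ball (g ω) r).Nonempty) => exists_measurable_refinement hF hg hr h
  let u : ℕ → Ω → X := fun n => Nat.rec (fun _ => d) (fun n g => next g (r / 2 ^ n)) n
  have hrn : ∀ n : ℕ, 0 < r / 2 ^ n := fun n => by positivity
  have hu : ∀ n, Measurable (u n) ∧ ∀ ω, (F ω ∩ Metric.ball (u n ω) (r / 2 ^ n)).Nonempty := by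
    intro n
    induction n with
    | zero => exact ⟨measurable_const, by simpa [u] using h⟩
    | succ n ih =>
      refine ⟨hnextm _ ih.1 _ (hrn n) ih.2, fun ω => ?_⟩
      rw [pow_succ, ← div_div]
      exact (hnext _ ih.1 _ (hrn n) ih.2 ω).1
  have hdist : ∀ ω n, dist (u n ω) (u (n + 1) ω) ≤ 4 * r / 2 / 2 ^ n := by
    intro ω n
    refine (hnext _ (hu n).1 _ (hrn n) (hu n).2 ω).2.trans (le_of_eq ?_)
    ring
  choose f hf using fun ω => cauchySeq_tendsto_of_complete (cauchySeq_of_le_geometric_two (hdist ω))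
  refine ⟨f, measurable_of_tendsto_metrizable (fun n => (hu n).1) (tendsto_pi_nhds.2 hf),
    fun ω => ⟨?_, dist_le_of_le_geometric_two_of_tendsto₀ (hdist ω) (hf ω)⟩⟩
  choose y hyF hy using fun n => (hu n).2 ω
  refine (hcl ω).mem_of_tendsto (tendsto_of_tendsto_of_dist (hf ω) ?_)
    (Filter.Eventually.of_forall hyF)
  have hr0 : Filter.Tendsto (fun n : ℕ => r / 2 ^ n) Filter.atTop (nhds 0) :=
    tendsto_const_nhds.div_atTop (tendsto_pow_atTop_atTop_of_one_lt one_lt_two)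
  refine squeeze_zero (fun _ => dist_nonneg) (fun n => ?_) hr0
  rw [dist_comm]
  exact (Metric.mem_ball.1 (hy n)).le

/-- A Castaing representation by `p`-integrable functions: every function of the countable family
agrees pointwise with a selection or with the given function `s`. -/
theorem exists_memLp_dense_selections [CompleteSpace X] {μ : Measure Ω} [IsFiniteMeasure μ]
    (hcl : ∀ ω, IsClosed (F ω))
    (hF : ∀ U : Set X, IsOpen U → MeasurableSet {ω : Ω | (F ω ∩ U).Nonempty})
    {p : ℝ≥0∞} {s : Ω → X} (hs : Measurable s) (hsp : MemLp s p μ) :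
    ∃ g : ℕ × ℕ → Ω → X, (∀ i, Measurable (g i) ∧ MemLp (g i) p μ) ∧
      (∀ i ω, g i ω ∈ F ω ∨ g i ω = s ω) ∧ ∀ ω, F ω ⊆ closure (Set.range fun i => g i ω) := by
  classical
  let d := TopologicalSpace.denseSeq X
  let r : ℕ → ℝ := fun m => 1 / ((m : ℝ) + 1)
  have hr : ∀ m, 0 < r m := fun m => Nat.one_div_pos_of_nat
  let B : ℕ × ℕ → Set Ω := fun i => {ω | (F ω ∩ Metric.ball (d i.1) (r i.2)).Nonempty}
  have hB : ∀ i, MeasurableSet (B i) := fun i => hF _ Metric.isOpen_ball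
  have hsel : ∀ i, ∃ f : Ω → X, Measurable f ∧
      ∀ ω, (ω ∈ B i → f ω ∈ F ω) ∧ dist (d i.1) (f ω) ≤ 4 * r i.2 := by
    intro i
    let F' : Ω → Set X := fun ω => if ω ∈ B i then F ω else {d i.1}
    obtain ⟨f, hfm, hf⟩ := exists_measurable_selection_of_ball (F := F') (d := d i.1) (r := r i.2)
      (fun ω => by
        by_cases h : ω ∈ B i
        · simpa [F', h] using hcl ω
        · simp [F', h])
      (fun U hU => by
        have : {ω | (F' ω ∩ U).Nonempty} =
            (B i).ite {ω | (F ω ∩ U).Nonempty} {_ω | d i.1 ∈ U} := by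
          ext ω
          by_cases h : ω ∈ B i <;> simp [F', h, Set.ite]
        rw [this]
        exact (hB i).ite (hF U hU) (.const _))
      (hr _)
      (fun ω => by
        by_cases h : ω ∈ B i
        · rw [show F' ω = F ω from if_pos h]
          exact h
        · simp [F', h, hr])
    refine ⟨f, hfm, fun ω => ⟨fun h => ?_, (hf ω).2⟩⟩
    simpa [F', h] using (hf ω).1
  choose f hfm hf using hsel
  refine ⟨fun i => (B i).piecewise (f i) s, fun i => ⟨(hfm i).piecewise (hB i) hs, ?_⟩,
    fun i ω => ?_, fun ω y hy => ?_⟩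
  · refine MemLp.piecewise (hB i) (MemLp.restrict _ ?_) (hsp.restrict _)
    refine MemLp.of_bound (hfm i).aestronglyMeasurable (‖d i.1‖ + 4 * r i.2)
      (Filter.Eventually.of_forall fun ω => ?_)
    have h := (hf i ω).2
    rw [dist_comm, dist_eq_norm] at h
    linarith [norm_sub_norm_le (f i ω) (d i.1)]
  · by_cases h : ω ∈ B i
    · exact Or.inl (by simpa [h] using (hf i ω).1 h)
    · exact Or.inr (by simp [h])
  · rw [Metric.mem_closure_range_iff]
    intro ε hε
    obtain ⟨m, hm⟩ := exists_nat_one_div_lt (show 0 < ε / 5 by linarith)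
    obtain ⟨k, hk⟩ := Metric.denseRange_iff.1 (TopologicalSpace.denseRange_denseSeq X) y (r m) (hr m)
    have hω : ω ∈ B (k, m) := ⟨y, hy, hk⟩
    refine ⟨(k, m), ?_⟩
    beta_reduce
    rw [Set.piecewise_eq_of_mem _ _ _ hω]
    have hrm : r m < ε / 5 := hm
    have h := (hf (k, m) ω).2
    calc dist y (f (k, m) ω) ≤ dist y (d k) + dist (d k) (f (k, m) ω) := dist_triangle _ _ _
      _ < ε := by dsimp only at h; linarith

end Selection

/-- A countable set is contained in a countable set stable under a binary operation; every
property inherited through the operation passes to the larger set. -/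
theorem Set.Countable.exists_superset_stable {α : Type*} {G : Set α} (hG : G.Countable)
    (op : α → α → α) {P : α → Prop} (hGP : ∀ x ∈ G, P x)
    (hop : ∀ x y, P x → P y → P (op x y)) :
    ∃ D : Set α, G ⊆ D ∧ D.Countable ∧ (∀ x ∈ D, ∀ y ∈ D, op x y ∈ D) ∧ ∀ x ∈ D, P x := by
  let D : ℕ → Set α := fun n => Nat.rec G (fun _ s => s ∪ Set.image2 op s s) n
  have hmono : Monotone D := monotone_nat_of_le_succ fun n => Set.subset_union_left
  have hcount : ∀ n, (D n).Countable := by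
    intro n
    induction n with
    | zero => exact hG
    | succ n ih => exact ih.union (ih.image2 ih op)
  have hP : ∀ n, ∀ x ∈ D n, P x := by
    intro n
    induction n with
    | zero => exact hGP
    | succ n ih =>
      rintro z (hz | ⟨x, hx, y, hy, rfl⟩)
      exacts [ih z hz, hop x y (ih x hx) (ih y hy)]
  refine ⟨⋃ n, D n, Set.subset_iUnion D 0, Set.countable_iUnion hcount, fun x hx y hy => ?_,
    fun x hx => ?_⟩
  · obtain ⟨m, hm⟩ := Set.mem_iUnion.1 hx
    obtain ⟨n, hn⟩ := Set.mem_iUnion.1 hy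
    exact Set.mem_iUnion.2 ⟨max m n + 1, Or.inr
      ⟨x, hmono (le_max_left m n) hm, y, hmono (le_max_right m n) hn, rfl⟩⟩
  · obtain ⟨n, hn⟩ := Set.mem_iUnion.1 hx
    exact hP n x hn

section Approximation

variable {Ω : Type*} [MeasurableSpace Ω] {μ : Measure Ω}
  {X : Type*} [NormedAddCommGroup X] {p : ℝ≥0∞}

theorem tendsto_toLp_of_norm_sub_le [IsFiniteMeasure μ] [Fact (1 ≤ p)] (hptop : p ≠ ⊤)
    {x b : Ω → X} {y : ℕ → Ω → X} (hx : MemLp x p μ) (hb : MemLp b p μ)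
    (hy : ∀ n, MemLp (y n) p μ) (hle : ∀ n ω, ‖y n ω - x ω‖ ≤ ‖b ω‖)
    (hlim : ∀ᵐ ω ∂μ, Filter.Tendsto (fun n => y n ω) Filter.atTop (nhds (x ω))) :
    Filter.Tendsto (fun n => (hy n).toLp (y n)) Filter.atTop (nhds (hx.toLp x)) := by
  rw [Lp.tendsto_Lp_iff_tendsto_eLpNorm'']
  have hui : UnifIntegrable (fun n => y n - x) p μ := by
    intro ε hε
    obtain ⟨δ, hδ0, hδ⟩ := hb.eLpNorm_indicator_le Fact.out hptop hε
    refine ⟨δ, hδ0, fun n s hs hsδ => le_trans (eLpNorm_mono fun ω => ?_) (hδ s hs hsδ)⟩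
    rw [norm_indicator_eq_indicator_norm, norm_indicator_eq_indicator_norm]
    exact Set.indicator_le_indicator (hle n ω)
  have h := tendsto_Lp_finite_of_tendsto_ae (f := fun n => y n - x) (g := 0) Fact.out hptop
    (fun n => ((hy n).sub hx).1) MemLp.zero' hui (by
      filter_upwards [hlim] with ω hω
      simpa using hω.sub_const (x ω))
  simpa using h

variable [NormedSpace ℝ X] [Fact (1 ≤ p)]

theorem toLp_piecewise {A : Set Ω} [DecidablePred (· ∈ A)] (hA : MeasurableSet A) {f g : Ω → X}
    (hf : MemLp f p μ) (hg : MemLp g p μ) (h : MemLp (A.piecewise f g) p μ) :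
    h.toLp _ = lpIndicator hA (hf.toLp f) + lpIndicator hA.compl (hg.toLp g) := by
  refine Lp.ext ?_
  filter_upwards [h.coeFn_toLp, hf.coeFn_toLp, hg.coeFn_toLp, coeFn_lpIndicator hA (hf.toLp f),
    coeFn_lpIndicator hA.compl (hg.toLp g),
    Lp.coeFn_add (lpIndicator hA (hf.toLp f)) (lpIndicator hA.compl (hg.toLp g))]
    with ω h₁ h₂ h₃ h₄ h₅ h₆
  rw [h₁, h₆, Pi.add_apply, h₄, h₅]
  by_cases hω : ω ∈ A <;> simp [hω, h₂, h₃]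

variable [MeasurableSpace X] [BorelSpace X] [TopologicalSpace.SeparableSpace X]

/-- A function which is pointwise approximated by a sequence from a closed decomposable subset of
`L^p` belongs to this subset. -/
theorem mem_of_mem_closure_range [IsFiniteMeasure μ] (hptop : p ≠ ⊤) {K : Set (Lp X p μ)}
    (hK : IsClosed K)
    (hdec : ∀ (A : Set Ω) (hA : MeasurableSet A), ∀ x ∈ K, ∀ y ∈ K,
      lpIndicator hA x + lpIndicator hA.compl y ∈ K)
    {h : ℕ → Ω → X} (hm : ∀ n, Measurable (h n)) (hLp : ∀ n, MemLp (h n) p μ)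
    (hhK : ∀ n, (hLp n).toLp (h n) ∈ K) {x : Lp X p μ}
    (hx : ∀ᵐ ω ∂μ, x ω ∈ closure (Set.range fun n => h n ω)) : x ∈ K := by
  classical
  have hxm : Measurable x := (Lp.stronglyMeasurable x).measurable
  let A : ℕ → (Ω → X) → Set Ω := fun n g => {ω | ‖h n ω - x ω‖ < ‖g ω - x ω‖}
  let y : ℕ → Ω → X := fun n => Nat.rec (h 0) (fun n g => (A n g).piecewise (h n) g) n
  have hsucc : ∀ n, y (n + 1) = (A n (y n)).piecewise (h n) (y n) := fun n => rfl
  have hA : ∀ n, Measurable (y n) → MeasurableSet (A n (y n)) := fun n hy =>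
    measurableSet_lt ((hm n).sub hxm).norm (hy.sub hxm).norm
  have hy : ∀ n, Measurable (y n) ∧ ∃ hn : MemLp (y n) p μ, hn.toLp (y n) ∈ K := by
    intro n
    induction n with
    | zero => exact ⟨hm 0, hLp 0, hhK 0⟩
    | succ n ih =>
      obtain ⟨hym, hyp, hyK⟩ := ih
      have hAn := hA n hym
      rw [hsucc]
      have hp : MemLp ((A n (y n)).piecewise (h n) (y n)) p μ :=
        MemLp.piecewise hAn ((hLp n).restrict _) (hyp.restrict _)
      refine ⟨(hm n).piecewise hAn hym, hp, ?_⟩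
      rw [toLp_piecewise hAn (hLp n) hyp]
      exact hdec _ hAn _ (hhK n) _ hyK
  choose hym hyp hyK using hy
  have hstep : ∀ n ω, ‖y (n + 1) ω - x ω‖ ≤ ‖h n ω - x ω‖ ∧
      ‖y (n + 1) ω - x ω‖ ≤ ‖y n ω - x ω‖ := by
    intro n ω
    rw [hsucc]
    by_cases hω : ω ∈ A n (y n)
    · rw [Set.piecewise_eq_of_mem _ _ _ hω]
      exact ⟨le_rfl, hω.le⟩
    · rw [Set.piecewise_eq_of_notMem _ _ _ hω]
      exact ⟨not_lt.1 hω, le_rfl⟩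
  have hanti : ∀ ω, Antitone fun n => ‖y n ω - x ω‖ := fun ω =>
    antitone_nat_of_succ_le fun n => (hstep n ω).2
  have hlim : ∀ᵐ ω ∂μ, Filter.Tendsto (fun n => y n ω) Filter.atTop (nhds (x ω)) := by
    filter_upwards [hx] with ω hω
    rw [Metric.tendsto_atTop]
    intro ε hε
    obtain ⟨k, hk⟩ := Metric.mem_closure_range_iff.1 hω ε hε
    refine ⟨k + 1, fun n hn => ?_⟩
    rw [dist_comm, dist_eq_norm] at hk
    rw [dist_eq_norm]
    exact ((hanti ω hn).trans (hstep k ω).1).trans_lt hk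
  have htend := tendsto_toLp_of_norm_sub_le hptop (Lp.memLp x) ((hyp 0).sub (Lp.memLp x)) hyp
    (fun n ω => hanti ω n.zero_le) hlim
  rw [Lp.toLp_coeFn] at htend
  exact hK.mem_of_tendsto htend (Filter.Eventually.of_forall hyK)

end Approximation

section Selections

variable {Ω : Type*} [MeasurableSpace Ω] {μ : Measure Ω}
  {X : Type*} [NormedAddCommGroup X] {p : ℝ≥0∞}

theorem isClosed_setOf_ae_mem [Fact (1 ≤ p)] {C : Ω → Set X} (hC : ∀ ω, IsClosed (C ω)) :
    IsClosed {x : Lp X p μ | ∀ᵐ ω ∂μ, x ω ∈ C ω} := by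
  refine IsSeqClosed.isClosed fun x l hx hl => ?_
  obtain ⟨ns, -, hns⟩ := (tendstoInMeasure_of_tendsto_Lp hl).exists_seq_tendsto_ae
  have hall : ∀ᵐ ω ∂μ, ∀ n, x n ω ∈ C ω := ae_all_iff.2 hx
  change ∀ᵐ ω ∂μ, l ω ∈ C ω
  filter_upwards [hns, hall] with ω h₁ h₂
  exact (hC ω).mem_of_tendsto h₁ (Filter.Eventually.of_forall fun n => h₂ _)

variable [NormedSpace ℝ X]

theorem convex_setOf_ae_mem {C : Ω → Set X} (hC : ∀ ω, Convex ℝ (C ω)) :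
    Convex ℝ {x : Lp X p μ | ∀ᵐ ω ∂μ, x ω ∈ C ω} := by
  intro x hx y hy a b ha hb hab
  have hx' : ∀ᵐ ω ∂μ, x ω ∈ C ω := hx
  have hy' : ∀ᵐ ω ∂μ, y ω ∈ C ω := hy
  change ∀ᵐ ω ∂μ, (a • x + b • y : Lp X p μ) ω ∈ C ω
  filter_upwards [hx', hy', Lp.coeFn_add (a • x) (b • y), Lp.coeFn_smul a x, Lp.coeFn_smul b y]
    with ω h₁ h₂ h₃ h₄ h₅
  rw [h₃, Pi.add_apply, h₄, h₅]
  exact hC ω h₁ h₂ ha hb hab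

variable [Fact (1 ≤ p)]

/-- On a non-atomic finite measure space, the weak closure of the set of `p`-integrable selections
of a measurable multifunction is the set of `p`-integrable selections of its closed convex hull. -/
theorem weakClosure_setOf_ae_mem [IsFiniteMeasure μ]
    (hna : ∀ s : Set Ω, MeasurableSet s → μ s ≠ 0 →
      ∃ t ⊆ s, MeasurableSet t ∧ μ t ≠ 0 ∧ μ t ≠ μ s)
    [CompleteSpace X] [TopologicalSpace.SeparableSpace X] [MeasurableSpace X] [BorelSpace X]
    (hptop : p ≠ ⊤) {M : Ω → Set X} (hMcl : ∀ ω, IsClosed (M ω))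
    (hMmeas : ∀ U : Set X, IsOpen U → MeasurableSet {ω : Ω | (M ω ∩ U).Nonempty})
    (hne : {x : Lp X p μ | ∀ᵐ ω ∂μ, x ω ∈ M ω}.Nonempty) :
    weakClosure {x : Lp X p μ | ∀ᵐ ω ∂μ, x ω ∈ M ω} =
      {x : Lp X p μ | ∀ᵐ ω ∂μ, x ω ∈ closure (convexHull ℝ (M ω))} := by
  set S : Set (Lp X p μ) := {x : Lp X p μ | ∀ᵐ ω ∂μ, x ω ∈ M ω}
  refine Set.Subset.antisymm ?_ fun x hx => ?_
  · refine weakClosure_subset_of_convex (fun x hx => ?_)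
      (convex_setOf_ae_mem fun ω => (convex_convexHull ℝ (M ω)).closure)
      (isClosed_setOf_ae_mem fun ω => isClosed_closure)
    have hx' : ∀ᵐ ω ∂μ, x ω ∈ M ω := hx
    change ∀ᵐ ω ∂μ, x ω ∈ closure (convexHull ℝ (M ω))
    filter_upwards [hx'] with ω hω
    exact subset_closure (subset_convexHull ℝ _ hω)
  have hdecS : ∀ (A : Set Ω) (hA : MeasurableSet A), ∀ x ∈ S, ∀ y ∈ S,
      lpIndicator hA x + lpIndicator hA.compl y ∈ S := by
    intro A hA x hx y hy
    have hx' : ∀ᵐ ω ∂μ, x ω ∈ M ω := hx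
    have hy' : ∀ᵐ ω ∂μ, y ω ∈ M ω := hy
    change ∀ᵐ ω ∂μ, (lpIndicator hA x + lpIndicator hA.compl y : Lp X p μ) ω ∈ M ω
    filter_upwards [hx', hy', Lp.coeFn_add (lpIndicator hA x) (lpIndicator hA.compl y),
      coeFn_lpIndicator hA x, coeFn_lpIndicator hA.compl y] with ω h₁ h₂ h₃ h₄ h₅
    rw [h₃, Pi.add_apply, h₄, h₅]
    by_cases hω : ω ∈ A <;> simp [hω, h₁, h₂]
  have hdec : ∀ (A : Set Ω) (hA : MeasurableSet A), ∀ x ∈ weakClosure S, ∀ y ∈ weakClosure S,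
      lpIndicator hA x + lpIndicator hA.compl y ∈ weakClosure S := fun A hA x hx y hy =>
    add_mem_weakClosure _ _ (fun a ha b hb => subset_weakClosure S (hdecS A hA a ha b hb)) hx hy
  obtain ⟨s, hs⟩ := hne
  have hs' : ∀ᵐ ω ∂μ, s ω ∈ M ω := hs
  obtain ⟨g, hg, hgM, hgdense⟩ := exists_memLp_dense_selections hMcl hMmeas
    (Lp.stronglyMeasurable s).measurable (Lp.memLp s)
  let P : (Ω → X) → Prop := fun f =>
    Measurable f ∧ ∃ hf : MemLp f p μ, hf.toLp f ∈ weakClosure S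
  obtain ⟨D, hgD, hDc, hDmid, hDP⟩ := (Set.countable_range g).exists_superset_stable
    (fun f f' => (1 / 2 : ℝ) • f + (1 / 2 : ℝ) • f') (P := P)
    (by
      rintro _ ⟨i, rfl⟩
      refine ⟨(hg i).1, (hg i).2, subset_weakClosure S ?_⟩
      change ∀ᵐ ω ∂μ, (hg i).2.toLp (g i) ω ∈ M ω
      filter_upwards [hs', (hg i).2.coeFn_toLp] with ω h₁ h₂
      rw [h₂]
      rcases hgM i ω with h | h
      exacts [h, h ▸ h₁])
    (by
      rintro f f' ⟨hfm, hf, hfK⟩ ⟨hfm', hf', hfK'⟩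
      refine ⟨(hfm.const_smul _).add (hfm'.const_smul _),
        (hf.const_smul _).add (hf'.const_smul _), ?_⟩
      rw [MemLp.toLp_add (hf.const_smul _) (hf'.const_smul _), MemLp.toLp_const_smul _ hf,
        MemLp.toLp_const_smul _ hf']
      exact half_add_mem_weakClosure hna hptop hdecS hfK hfK')
  obtain ⟨h, rfl⟩ := hDc.exists_eq_range ((Set.range_nonempty g).mono hgD)
  choose hhm hhLp hhK using fun n => hDP (h n) (Set.mem_range_self n)
  refine mem_of_mem_closure_range hptop (isClosed_weakClosure S) hdec hhm hhLp hhK ?_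
  have hx' : ∀ᵐ ω ∂μ, x ω ∈ closure (convexHull ℝ (M ω)) := hx
  filter_upwards [hx'] with ω hω
  have hconv : Convex ℝ (closure (Set.range fun n => h n ω)) := by
    refine isClosed_closure.convex_of_half_add fun a ha b hb => ?_
    have hcont : Continuous (Function.uncurry fun a b : X => (1 / 2 : ℝ) • a + (1 / 2 : ℝ) • b) := by
      unfold Function.uncurry
      fun_prop
    refine map_mem_closure₂ (f := fun a b : X => (1 / 2 : ℝ) • a + (1 / 2 : ℝ) • b) hcont ha hb ?_
    rintro _ ⟨m, rfl⟩ _ ⟨n, rfl⟩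
    obtain ⟨k, hk⟩ := hDmid _ (Set.mem_range_self m) _ (Set.mem_range_self n)
    exact ⟨k, congr_fun hk ω⟩
  refine closure_minimal (convexHull_min ((hgdense ω).trans (closure_mono ?_)) hconv)
    isClosed_closure hω
  rintro _ ⟨i, rfl⟩
  obtain ⟨k, hk⟩ := hgD (Set.mem_range_self i)
  exact ⟨k, congr_fun hk ω⟩

end Selections

/-- Let `(Ω, 𝒜, μ)` be a non-atomic finite measure space, `X` a separable Banach space,
`p ∈ [1,∞)`, and `M : Ω ⇉ X` a measurable multifunction with nonempty closed values whose
set `S_M^p` of `p`-integrable selections is nonempty. If `φ : Ω × X → [0,∞)` is a convex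
normal integrand with `{x : φ_ω(x) = 0} = cl co M(ω)` a.e. and finite integral functional
on `L^p`, then the weak closure of `S_M^p` in `L^p(Ω, X)` equals
`{x ∈ L^p : ∫ φ_ω(x(ω)) dμ = 0}`. -/
theorem stmt19 {Ω : Type*} [MeasurableSpace Ω] (μ : Measure Ω) [IsFiniteMeasure μ]
    (hna : ∀ s : Set Ω, MeasurableSet s → μ s ≠ 0 →
      ∃ t ⊆ s, MeasurableSet t ∧ μ t ≠ 0 ∧ μ t ≠ μ s)
    {X : Type*} [NormedAddCommGroup X] [NormedSpace ℝ X] [CompleteSpace X]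
    [TopologicalSpace.SeparableSpace X] [MeasurableSpace X] [BorelSpace X]
    (p : ℝ≥0∞) (hp : 1 ≤ p) (hptop : p ≠ ⊤) [Fact (1 ≤ p)]
    (M : Ω → Set X)
    (hMne : ∀ ω, (M ω).Nonempty) (hMcl : ∀ ω, IsClosed (M ω))
    (hMmeas : ∀ U : Set X, IsOpen U → MeasurableSet {ω : Ω | (M ω ∩ U).Nonempty})
    (S : Set (Lp X p μ)) (hS : S = {x : Lp X p μ | ∀ᵐ ω ∂μ, x ω ∈ M ω})
    (hSne : S.Nonempty)
    (φ : Ω → X → ℝ)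
    (hφmeas : Measurable (Function.uncurry φ))
    (hφlsc : ∀ ω, LowerSemicontinuous (φ ω))
    (hφconv : ∀ ω, ConvexOn ℝ Set.univ (φ ω))
    (hφnonneg : ∀ ω x, 0 ≤ φ ω x)
    (hφzero : ∀ᵐ ω ∂μ, {x : X | φ ω x = 0} = closure (convexHull ℝ (M ω)))
    (hφfin : ∀ x : Lp X p μ, Integrable (fun ω => φ ω (x ω)) μ) :
    @closure (Lp X p μ) (inferInstance : TopologicalSpace (WeakSpace ℝ (Lp X p μ))) S
      = {x : Lp X p μ | ∫ ω, φ ω (x ω) ∂μ = 0} := by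
  have hweak : weakClosure S = {x : Lp X p μ | ∫ ω, φ ω (x ω) ∂μ = 0} := by
    rw [hS, weakClosure_setOf_ae_mem hna hptop hMcl hMmeas (hS ▸ hSne)]
    ext x
    rw [Set.mem_ofPred_eq, Set.mem_ofPred_eq,
      integral_eq_zero_iff_of_nonneg (fun ω => hφnonneg ω (x ω)) (hφfin x)]
    refine Filter.eventually_congr ?_
    filter_upwards [hφzero] with ω hω
    rw [← hω]
    rfl
  rw [← hweak]
  have himage : toWeakSpace ℝ (Lp X p μ) '' S = S := Set.image_id S
  rw [weakClosure, himage]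
  rfl
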